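/- arXiv:2106.14931 — 4 statements merged into one kernel-verified Lean document; each statement's English description precedes it below -/
import Mathlib

section
/- Let A be a finite tree, let α be a path in A with endpoints a and b, and let q ≥ 0 be an integer such that every vertex of A lies within graph distance q of some vertex of α. Let s denote the symmetry of α exchanging its endpoints, i.e., for each vertex y of α, s(y) is the unique vertex of α with d(a, s(y)) = d(b, y). Then for all vertices z, z' of A and every vertex y of α, d(y, z) + d(s(y), z') ≤ |E(A)| + max(|α|, q), where |α| denotes the length of α. -/
namespace SimpleGraph

variable {V : Type*} {A : SimpleGraph V} {a b : V} {p : A.Walk a b}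

/-- In an acyclic graph, every path is a geodesic. -/
lemma IsAcyclic.length_eq_dist (hA : A.IsAcyclic) (hp : p.IsPath) : p.length = A.dist a b := by
  obtain ⟨w, hw, hl⟩ := p.reachable.exists_path_of_dist
  rw [← hl]
  exact congrArg (fun r : A.Path a b => r.1.length)
    ((hA.subsingleton_path a b).elim ⟨p, hp⟩ ⟨w, hw⟩)

/-- Distances add up along a path in an acyclic graph. -/
lemma IsAcyclic.dist_add_dist (hA : A.IsAcyclic) (hp : p.IsPath) {y : V} (hy : y ∈ p.support) :
    A.dist a y + A.dist y b = A.dist a b := by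
  obtain ⟨s, t, hs, ht, rfl⟩ := hp.mem_support_iff_exists_append.mp hy
  rw [← hA.length_eq_dist hp, ← hA.length_eq_dist hs, ← hA.length_eq_dist ht, Walk.length_append]

/-- The distance between two vertices of a path in an acyclic graph is the difference of their
distances from the starting point. -/
lemma IsAcyclic.dist_eq_sub (hA : A.IsAcyclic) (hp : p.IsPath) {x y : V} (hx : x ∈ p.support)
    (hy : y ∈ p.support) :
    A.dist a x + A.dist x y = A.dist a y ∨ A.dist a y + A.dist x y = A.dist a x := by
  have hxb := hA.dist_add_dist hp hx
  have hyb := hA.dist_add_dist hp hy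
  obtain ⟨s, t, hs, ht, rfl⟩ := hp.mem_support_iff_exists_append.mp hx
  rcases (Walk.mem_support_append_iff s t).mp hy with h | h
  · right
    rw [A.dist_comm (u := x) (v := y)]
    exact hA.dist_add_dist hs h
  · left
    have := hA.dist_add_dist ht h
    omega

/-- The nearest vertex of a walk is a gate to the other vertices of the walk. -/
lemma IsTree.dist_eq_add_of_nearest (hA : A.IsTree) {v r x : V}
    (hr : r ∈ p.support) (hmin : ∀ y ∈ p.support, A.dist v r ≤ A.dist v y)
    (hx : x ∈ p.support) : A.dist v x = A.dist v r + A.dist r x := by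
  classical
  obtain ⟨w, hw, hl⟩ := hA.connected.exists_path_of_dist v r
  let q := ((p.takeUntil r hr).reverse.append (p.takeUntil x hx)).bypass
  have hq : q.IsPath := Walk.bypass_isPath _
  have hqp : ∀ y ∈ q.support, y ∈ p.support := by
    intro y hy
    have := Walk.support_bypass_subset_support _ hy
    rw [Walk.mem_support_append_iff, Walk.support_reverse, List.mem_reverse] at this
    exact this.elim (fun h => p.support_takeUntil_subset_support hr h)
      (fun h => p.support_takeUntil_subset_support hx h)
  have hwq : (w.append q).IsPath := by
    rw [Walk.isPath_def, Walk.support_append]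
    have hnd := hq.support_nodup
    rw [← Walk.cons_tail_support, List.nodup_cons] at hnd
    refine List.Nodup.append hw.support_nodup hnd.2 fun y hyw hyq => ?_
    have hadd := hA.isAcyclic.dist_add_dist hw hyw
    have hle := hmin y (hqp y (List.mem_of_mem_tail hyq))
    have hyr : y = r := hA.connected.dist_eq_zero_iff.mp (by omega)
    exact hnd.1 (hyr ▸ hyq)
  rw [← hA.isAcyclic.length_eq_dist hwq, Walk.length_append, hl, hA.isAcyclic.length_eq_dist hq]

/-- A nearest vertex of a walk to `z` is also nearest to each vertex on a geodesic from `z`. -/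
lemma IsTree.nearest_of_dist_add_dist (hA : A.IsTree) {z v r : V}
    (hmin : ∀ y ∈ p.support, A.dist z r ≤ A.dist z y)
    (hv : A.dist z v + A.dist v r = A.dist z r) :
    ∀ y ∈ p.support, A.dist v r ≤ A.dist v y := by
  intro y hy
  have h1 := hmin y hy
  have h2 := hA.connected.dist_triangle (u := z) (v := v) (w := y)
  omega

/-- The vertices, other than `r` itself, of the geodesic from `z` to a nearest vertex `r` of a
walk. -/
lemma IsTree.exists_branch [DecidableEq V] (hA : A.IsTree) {z r : V}
    (hmin : ∀ y ∈ p.support, A.dist z r ≤ A.dist z y) :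
    ∃ T : Finset V, T.card = A.dist z r ∧ Disjoint p.support.toFinset T ∧
      ∀ v ∈ T, ∀ y ∈ p.support, A.dist v r ≤ A.dist v y := by
  obtain ⟨w, hw, hl⟩ := hA.connected.exists_path_of_dist z r
  refine ⟨w.support.toFinset.erase r, ?_, ?_, ?_⟩
  · rw [Finset.card_erase_of_mem (by simp), List.toFinset_card_of_nodup hw.support_nodup,
      Walk.length_support, hl, Nat.add_sub_cancel]
  · rw [Finset.disjoint_left]
    intro v hvp hvw
    rw [List.mem_toFinset] at hvp
    rw [Finset.mem_erase, List.mem_toFinset] at hvw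
    have hadd := hA.isAcyclic.dist_add_dist hw hvw.2
    have hle := hmin v hvp
    exact hvw.1 (hA.connected.dist_eq_zero_iff.mp (by omega))
  · intro v hv
    rw [Finset.mem_erase, List.mem_toFinset] at hv
    exact hA.nearest_of_dist_add_dist hmin (hA.isAcyclic.dist_add_dist hw hv.2)

end SimpleGraph

/-- **Tree inequality (Mackay–Przytycki Sublemma 4.7).**
Let `A` be a finite tree, `α` a path in `A` from `a` to `b` (given as a walk `p` that is a
path), and `q ≥ 0` an integer such that every vertex of `A` lies within graph distance `q`
of some vertex of `α`.  If `y` is a vertex of `α` and `sy` is the image of `y` under the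
symmetry of `α` exchanging its endpoints (i.e. `sy` lies on `α` and `d(a, sy) = d(b, y)`),
then for all vertices `z, z'` we have
`d(y, z) + d(sy, z') ≤ |E(A)| + max (|α|) q`. -/
theorem tree_inequality
    {V : Type*} [Fintype V] [DecidableEq V]
    (A : SimpleGraph V) [DecidableRel A.Adj]
    (hA : A.IsTree)
    {a b : V} (p : A.Walk a b) (hp : p.IsPath)
    (q : ℕ)
    (hq : ∀ v : V, ∃ y ∈ p.support, A.dist v y ≤ q)
    (y : V) (hy : y ∈ p.support)
    (sy : V) (hsy : sy ∈ p.support)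
    (hsym : A.dist a sy = A.dist b y)
    (z z' : V) :
    A.dist y z + A.dist sy z' ≤ A.edgeFinset.card + max p.length q := by
  have hnear : ∀ v : V, ∃ r ∈ p.support, ∀ x ∈ p.support, A.dist v r ≤ A.dist v x := by
    intro v
    obtain ⟨r, hr, hmin⟩ := p.support.toFinset.exists_min_image (A.dist v) ⟨a, by simp⟩
    exact ⟨r, by simpa using hr, fun x hx => hmin x (by simpa using hx)⟩
  have hac := hA.isAcyclic
  obtain ⟨r, hr, hmin⟩ := hnear z
  obtain ⟨r', hr', hmin'⟩ := hnear z'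
  obtain ⟨T, hTc, hTp, hT⟩ := hA.exists_branch hmin
  obtain ⟨T', hTc', hTp', hT'⟩ := hA.exists_branch hmin'
  have hcard := hA.card_edgeFinset
  have hpc : p.support.toFinset.card = p.length + 1 := by
    rw [List.toFinset_card_of_nodup hp.support_nodup, SimpleGraph.Walk.length_support]
  have hE : p.length + A.dist z r ≤ A.edgeFinset.card := by
    have := Finset.card_le_univ (p.support.toFinset ∪ T)
    rw [Finset.card_union_of_disjoint hTp] at this
    omega
  have hE' : p.length + A.dist z' r' ≤ A.edgeFinset.card := by
    have := Finset.card_le_univ (p.support.toFinset ∪ T')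
    rw [Finset.card_union_of_disjoint hTp'] at this
    omega
  have hzq : A.dist z r ≤ q := by
    obtain ⟨x, hx, hxq⟩ := hq z
    exact (hmin x hx).trans hxq
  have hyz := hA.connected.dist_triangle (u := y) (v := r) (w := z)
  have hyz' := hA.connected.dist_triangle (u := sy) (v := r') (w := z')
  rw [A.dist_comm (u := r)] at hyz
  rw [A.dist_comm (u := r')] at hyz'
  have hlen := hac.length_eq_dist hp
  have hyb := hac.dist_add_dist hp hy
  have hsb := hac.dist_add_dist hp hsy
  have hrb := hac.dist_add_dist hp hr
  have hrb' := hac.dist_add_dist hp hr'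
  have hyr := hac.dist_eq_sub hp hy hr
  have hsr := hac.dist_eq_sub hp hsy hr'
  rw [A.dist_comm (u := b)] at hsym
  by_cases hrr : r = r'
  · subst hrr
    omega
  · have hTT : Disjoint (p.support.toFinset ∪ T) T' := by
      rw [Finset.disjoint_union_left]
      refine ⟨hTp', Finset.disjoint_left.mpr fun v hv hv' => hrr ?_⟩
      have h1 := hA.dist_eq_add_of_nearest hr (hT v hv) hr'
      have h2 := hT' v hv' r hr
      exact hA.connected.dist_eq_zero_iff.mp (by omega)
    have := Finset.card_le_univ ((p.support.toFinset ∪ T) ∪ T')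
    rw [Finset.card_union_of_disjoint hTT, Finset.card_union_of_disjoint hTp] at this
    omega
end

section
/- Let q ≥ 0 be an integer and let A be a finite tree that is long in the sense that 2·diam(A) > |E(A)| + q. Then any two diametral paths of A (paths of length diam(A)) have strictly more than q edges in common. -/
/-- The edges of a path, as a finset, are as many as its length. -/
theorem SimpleGraph.Walk.IsPath.card_toFinset_edges {V : Type*} [DecidableEq V]
    {G : SimpleGraph V} {u v : V} {p : G.Walk u v} (hp : p.IsPath) :
    p.edges.toFinset.card = p.length := by
  rw [List.toFinset_card_of_nodup hp.isTrail.edges_nodup, SimpleGraph.Walk.length_edges]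

/-- The edges of a walk, as a finset, are edges of the graph. -/
theorem SimpleGraph.Walk.toFinset_edges_subset_edgeFinset {V : Type*} [DecidableEq V]
    {G : SimpleGraph V} [Fintype G.edgeSet] {u v : V} (p : G.Walk u v) :
    p.edges.toFinset ⊆ G.edgeFinset := fun _ he ↦
  SimpleGraph.mem_edgeFinset.2 (p.edges_subset_edgeSet (List.mem_toFinset.1 he))

/-- **Diametral paths of a long tree overlap a lot.**
Let `q ≥ 0` be an integer and let `A` be a finite tree that is *long* in the sense that
`2 * diam A > |E(A)| + q`.  Then any two diametral paths of `A` (paths of length `diam A`)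
have strictly more than `q` edges in common. -/
theorem long_tree_diametral_paths_overlap
    {V : Type*} [Fintype V] [DecidableEq V]
    (A : SimpleGraph V) [DecidableRel A.Adj]
    (hA : A.IsTree)
    (q : ℕ)
    (hlong : 2 * A.diam > A.edgeFinset.card + q)
    {u v u' v' : V}
    (D : A.Walk u v) (hD : D.IsPath) (hDlen : D.length = A.diam)
    (D' : A.Walk u' v') (hD' : D'.IsPath) (hD'len : D'.length = A.diam) :
    q < (D.edges.toFinset ∩ D'.edges.toFinset).card := by
  have hunion : (D.edges.toFinset ∪ D'.edges.toFinset).card ≤ A.edgeFinset.card :=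
    Finset.card_le_card <| Finset.union_subset D.toFinset_edges_subset_edgeFinset
      D'.toFinset_edges_subset_edgeFinset
  have hsum := Finset.card_union_add_card_inter D.edges.toFinset D'.edges.toFinset
  rw [hD.card_toFinset_edges, hD'.card_toFinset_edges, hDlen, hD'len] at hsum
  lia
end

section
/- Let q ≥ 1 be an integer and let A be a finite tree with |E(A)| ≤ 2q and 2·diam(A) > |E(A)| + q. Let D be a diametral path of A with endpoints u₋ and u₊, and let D̃ be a diametral path of A with endpoints ũ₋ and ũ₊, labeled so that d(u₋, ũ₋) < d(u₋, ũ₊). Then for every vertex x of A, d(x, u₋) ≤ q if and only if d(x, ũ₋) ≤ q. Consequently, the region of A defined as the complement of the q-neighborhood of the endpoint u₋ of a diametral path does not depend on the choice of diametral path (with the endpoints matched as above). -/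
namespace SimpleGraph

variable {V : Type*} {A : SimpleGraph V}

/-- In a connected graph, deleting the edge `ab` leaves every vertex connected to `a` or `b`. -/
theorem Connected.reachable_deleteEdges_or (hA : A.Connected) (a b x : V) :
    (A.deleteEdges {s(a, b)}).Reachable x a ∨ (A.deleteEdges {s(a, b)}).Reachable x b := by
  suffices H : ∀ {u c : V}, A.Walk u c → c = a →
      (A.deleteEdges {s(a, b)}).Reachable u a ∨ (A.deleteEdges {s(a, b)}).Reachable u b by
    obtain ⟨p⟩ := hA.preconnected x a
    exact H p rfl
  intro u c p hc
  induction p with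
  | nil => exact Or.inl (hc ▸ Reachable.refl _)
  | @cons u v w h p ih =>
    by_cases he : s(u, v) = s(a, b)
    · rcases Sym2.eq_iff.1 he with ⟨hu, -⟩ | ⟨hu, -⟩
      · exact Or.inl (by rw [hu])
      · exact Or.inr (by rw [hu])
    · have huv : (A.deleteEdges {s(a, b)}).Reachable u v :=
        Adj.reachable (by simp [deleteEdges_adj, h, he])
      exact (ih hc).imp huv.trans huv.trans

/-- Deleting one edge of a connected graph leaves at most two components. -/
theorem Connected.reachable_deleteEdges_of_three (hA : A.Connected) (e : Sym2 V) (x y z : V) :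
    (A.deleteEdges {e}).Reachable x y ∨ (A.deleteEdges {e}).Reachable y z ∨
      (A.deleteEdges {e}).Reachable x z := by
  induction e with
  | _ a b =>
    rcases hA.reachable_deleteEdges_or a b x with hx | hx <;>
    rcases hA.reachable_deleteEdges_or a b y with hy | hy <;>
    rcases hA.reachable_deleteEdges_or a b z with hz | hz <;>
    first
    | exact Or.inl (hx.trans hy.symm)
    | exact Or.inr (Or.inl (hy.trans hz.symm))
    | exact Or.inr (Or.inr (hx.trans hz.symm))

theorem IsAcyclic.eq_of_isPath (hA : A.IsAcyclic) {x y : V} {p r : A.Walk x y}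
    (hp : p.IsPath) (hr : r.IsPath) : p = r :=
  have := hA.subsingleton_path x y
  congrArg Subtype.val (Subsingleton.elim (⟨p, hp⟩ : A.Path x y) ⟨r, hr⟩)

theorem IsTree.length_eq_dist_of_isPath (hA : A.IsTree) {x y : V} {p : A.Walk x y}
    (hp : p.IsPath) : p.length = A.dist x y := by
  obtain ⟨r, hr, hlen⟩ := hA.connected.exists_path_of_dist x y
  rw [hA.isAcyclic.eq_of_isPath hp hr, hlen]

/-- In an acyclic graph, an edge lies on a path iff deleting it separates the endpoints. -/
theorem IsAcyclic.mem_edges_iff_not_reachable_deleteEdges (hA : A.IsAcyclic) {x y : V}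
    {p : A.Walk x y} (hp : p.IsPath) (e : Sym2 V) :
    e ∈ p.edges ↔ ¬ (A.deleteEdges {e}).Reachable x y := by
  classical
  refine ⟨fun he hr => ?_, fun hr => ?_⟩
  · obtain ⟨r, hr⟩ := hr.exists_isPath
    have hle : A.deleteEdges {e} ≤ A := deleteEdges_le _
    have heq : p = r.mapLe hle :=
      hA.eq_of_isPath hp (hr.mapLe hle)
    have hmem : e ∈ r.edges := by simpa [heq] using he
    have := r.edges_subset_edgeSet hmem
    simp [edgeSet_deleteEdges] at this
  · by_contra he
    exact hr ⟨p.toDeleteEdge e he⟩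

open Classical in
/-- The distance in a finite tree counts the edges separating the two vertices. -/
theorem IsTree.dist_eq_sum_edgeFinset [Fintype A.edgeSet] (hA : A.IsTree) (x y : V) :
    A.dist x y =
      ∑ e ∈ A.edgeFinset, if (A.deleteEdges {e}).Reachable x y then 0 else 1 := by
  obtain ⟨p, hp, hlen⟩ := hA.connected.exists_path_of_dist x y
  have hset : p.edges.toFinset =
      A.edgeFinset.filter fun e => ¬ (A.deleteEdges {e}).Reachable x y := by
    ext e
    rw [List.mem_toFinset, Finset.mem_filter,
      ← hA.isAcyclic.mem_edges_iff_not_reachable_deleteEdges hp, mem_edgeFinset]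
    exact ⟨fun h => ⟨p.edges_subset_edgeSet h, h⟩, And.right⟩
  rw [← hlen, ← p.length_edges, ← List.toFinset_card_of_nodup hp.isTrail.edges_nodup, hset,
    Finset.card_filter]
  exact Finset.sum_congr rfl fun e _ => by split_ifs <;> rfl

/-- The splits `xy|zw` and `xz|yw` cannot both be induced by edges of a tree. -/
theorem IsTree.not_crossing_splits (hA : A.IsTree) {x y z w : V} {e f : Sym2 V}
    (hxy : (A.deleteEdges {e}).Reachable x y) (hzw : (A.deleteEdges {e}).Reachable z w)
    (hxz : ¬ (A.deleteEdges {e}).Reachable x z)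
    (hxy' : ¬ (A.deleteEdges {f}).Reachable x y)
    (hzw' : ¬ (A.deleteEdges {f}).Reachable z w) : False := by
  classical
  have key : ∀ {a b s t : V}, (A.deleteEdges {e}).Reachable a b →
      ¬ (A.deleteEdges {s(s, t)}).Reachable a b → (A.deleteEdges {e}).Reachable a s := by
    intro a b s t hab hab'
    obtain ⟨p, hp⟩ := (hA.connected.preconnected a b).exists_isPath
    have he : e ∉ p.edges := fun h =>
      (hA.isAcyclic.mem_edges_iff_not_reachable_deleteEdges hp e).1 h hab
    have hs : s ∈ p.support := p.fst_mem_support_of_mem_edges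
      ((hA.isAcyclic.mem_edges_iff_not_reachable_deleteEdges hp _).2 hab')
    exact ⟨(p.takeUntil s hs).toDeleteEdge e fun h => he (p.edges_takeUntil_subset_edges hs h)⟩
  induction f with
  | _ s t => exact hxz ((key hxy hxy').trans (key hzw hzw').symm)

/-- If no edge of a finite tree splits four vertices as `xz|yw` or `xw|yz`, then the pairing
`xy, zw` is the shortest of the three, the other two pairings have equal length, and the closed
tour through the four vertices traverses each edge at most twice. -/
theorem IsTree.dist_pairings_of_split [Fintype A.edgeSet] (hA : A.IsTree) {x y z w : V}
    (hxz : ∀ e ∈ A.edgeFinset, ¬ ((A.deleteEdges {e}).Reachable x z ∧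
      (A.deleteEdges {e}).Reachable y w ∧ ¬ (A.deleteEdges {e}).Reachable x y))
    (hxw : ∀ e ∈ A.edgeFinset, ¬ ((A.deleteEdges {e}).Reachable x w ∧
      (A.deleteEdges {e}).Reachable y z ∧ ¬ (A.deleteEdges {e}).Reachable x y)) :
    A.dist x z + A.dist y w = A.dist x w + A.dist y z ∧
      A.dist x y + A.dist z w ≤ A.dist x z + A.dist y w ∧
      A.dist x y + A.dist z w + A.dist x z + A.dist y w ≤ 2 * A.edgeFinset.card := by
  classical
  have htwo : 2 * A.edgeFinset.card = ∑ e ∈ A.edgeFinset, 2 := by simp [mul_comm]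
  simp only [hA.dist_eq_sum_edgeFinset, htwo, ← Finset.sum_add_distrib]
  have edge : ∀ e ∈ A.edgeFinset, ∀ R : V → V → Prop, R = (A.deleteEdges {e}).Reachable →
      ((if R x z then 0 else 1) + (if R y w then 0 else 1) =
        (if R x w then 0 else 1) + (if R y z then 0 else 1)) ∧
      ((if R x y then 0 else 1) + (if R z w then 0 else 1) ≤
        (if R x z then 0 else 1) + (if R y w then 0 else 1)) ∧
      ((if R x y then 0 else 1) + (if R z w then 0 else 1) + (if R x z then 0 else 1) +
        (if R y w then 0 else 1) ≤ 2) := by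
    intro e he R hR
    have h1 := hxz e he
    have h2 := hxw e he
    have three := hA.connected.reachable_deleteEdges_of_three e
    have symm : ∀ {a b}, R a b → R b a := by subst hR; exact Reachable.symm
    have trans : ∀ {a b c}, R a b → R b c → R a c := by subst hR; exact Reachable.trans
    rw [← hR] at h1 h2 three
    have t1 := three x y z
    have t2 := three x y w
    have t3 := three x z w
    have t4 := three y z w
    clear hR hxz hxw htwo three
    grind
  exact ⟨Finset.sum_congr rfl fun e he => (edge e he _ rfl).1,
    Finset.sum_le_sum fun e he => (edge e he _ rfl).2.1,
    Finset.sum_le_sum fun e he => (edge e he _ rfl).2.2⟩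

/-- The four-point condition for finite trees, together with the bound on the closed tour. -/
theorem IsTree.dist_pairings [Fintype A.edgeSet] (hA : A.IsTree) (x y z w : V) :
    (A.dist x z + A.dist y w = A.dist x w + A.dist y z ∧
      A.dist x y + A.dist z w ≤ A.dist x z + A.dist y w ∧
      A.dist x y + A.dist z w + A.dist x z + A.dist y w ≤ 2 * A.edgeFinset.card) ∨
    (A.dist x y + A.dist z w = A.dist x w + A.dist z y ∧
      A.dist x z + A.dist y w ≤ A.dist x y + A.dist z w ∧
      A.dist x z + A.dist y w + A.dist x y + A.dist z w ≤ 2 * A.edgeFinset.card) ∨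
    (A.dist x y + A.dist w z = A.dist x z + A.dist w y ∧
      A.dist x w + A.dist y z ≤ A.dist x y + A.dist w z ∧
      A.dist x w + A.dist y z + A.dist x y + A.dist w z ≤ 2 * A.edgeFinset.card) := by
  have transfer : ∀ {e : Sym2 V} {a b c d : V}, (A.deleteEdges {e}).Reachable a c →
      (A.deleteEdges {e}).Reachable b d → ¬ (A.deleteEdges {e}).Reachable a b →
      ¬ (A.deleteEdges {e}).Reachable c d := fun hac hbd hab hcd =>
    hab ((hac.trans hcd).trans hbd.symm)
  by_cases hxz : ∃ e, (A.deleteEdges {e}).Reachable x z ∧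
      (A.deleteEdges {e}).Reachable y w ∧ ¬ (A.deleteEdges {e}).Reachable x y
  · obtain ⟨e, h1, h2, h3⟩ := hxz
    refine Or.inr (Or.inl (hA.dist_pairings_of_split ?_ ?_))
    · rintro f - ⟨g1, g2, g3⟩
      exact hA.not_crossing_splits h1 h2 h3 g3 (transfer g1 g2 g3)
    · rintro f - ⟨g1, g2, g3⟩
      exact hA.not_crossing_splits h1 h2 h3 g3 fun h => transfer g1 g2 g3 h.symm
  by_cases hxw : ∃ e, (A.deleteEdges {e}).Reachable x w ∧
      (A.deleteEdges {e}).Reachable y z ∧ ¬ (A.deleteEdges {e}).Reachable x y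
  · obtain ⟨e, h1, h2, h3⟩ := hxw
    refine Or.inr (Or.inr (hA.dist_pairings_of_split ?_ ?_))
    · rintro f - ⟨g1, g2, g3⟩
      exact hA.not_crossing_splits h1 h2 h3 g3 (transfer g1 g2 g3)
    · rintro f - ⟨g1, g2, g3⟩
      exact hA.not_crossing_splits h1 h2 h3 g3 fun h => transfer g1 g2 g3 h.symm
  · exact Or.inl (hA.dist_pairings_of_split (fun e _ h => hxz ⟨e, h⟩) fun e _ h => hxw ⟨e, h⟩)

/-- In a long tree, a vertex close to one of two vertices at diametral distance from a common
vertex is close to the other one. -/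
theorem IsTree.dist_le_of_dist_eq_diam [Fintype A.edgeSet] (hA : A.IsTree) {q : ℕ}
    (hsize : A.edgeFinset.card ≤ 2 * q) (hlong : 2 * A.diam > A.edgeFinset.card + q)
    {u u' v x : V} (hu : A.dist u v = A.diam) (hu' : A.dist u' v = A.diam)
    (hx : A.dist x u ≤ q) : A.dist x u' ≤ q := by
  have pairs := hA.dist_pairings u u' v x
  have c1 := A.dist_comm (u := u) (v := x)
  have c2 := A.dist_comm (u := u') (v := x)
  have c3 := A.dist_comm (u := v) (v := x)
  have c4 := A.dist_comm (u := v) (v := u')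
  omega

end SimpleGraph

/-- **Well-definedness of the regions `α±` of a long tree.**
Let `q ≥ 1` be an integer and let `A` be a finite tree with `|E(A)| ≤ 2q` and
`2 * diam A > |E(A)| + q`.  Let `D` be a diametral path of `A` with endpoints `u₋, u₊`, and
let `D̃` be a diametral path of `A` with endpoints `ũ₋, ũ₊`, labeled so that
`d(u₋, ũ₋) < d(u₋, ũ₊)`.  Then for every vertex `x` of `A` we have
`d(x, u₋) ≤ q ↔ d(x, ũ₋) ≤ q`; i.e. the complement of the `q`-neighborhood of the endpoint
`u₋` does not depend on the choice of diametral path (with endpoints matched as above). -/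
theorem long_tree_regions_well_defined
    {V : Type*} [Fintype V] [DecidableEq V]
    (A : SimpleGraph V) [DecidableRel A.Adj]
    (hA : A.IsTree)
    (q : ℕ) (hq : 1 ≤ q)
    (hsize : A.edgeFinset.card ≤ 2 * q)
    (hlong : 2 * A.diam > A.edgeFinset.card + q)
    {um up tum tup : V}
    (D : A.Walk um up) (hD : D.IsPath) (hDlen : D.length = A.diam)
    (Dt : A.Walk tum tup) (hDt : Dt.IsPath) (hDtlen : Dt.length = A.diam)
    (hlabel : A.dist um tum < A.dist um tup) :
    ∀ x : V, A.dist x um ≤ q ↔ A.dist x tum ≤ q := by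
  have hle : ∀ a b, A.dist a b ≤ A.diam := fun a b => by
    have := hA.connected.nonempty
    exact SimpleGraph.dist_le_diam (SimpleGraph.connected_iff_ediam_ne_top.1 hA.connected)
  rw [hA.length_eq_dist_of_isPath hD] at hDlen
  rw [hA.length_eq_dist_of_isPath hDt] at hDtlen
  have hdist : A.dist tum up = A.diam := by
    have pairs := hA.dist_pairings um up tum tup
    have h1 := hle um tum
    have h2 := hle up tup
    have h3 := hle um tup
    have h4 := hle up tum
    have c1 := A.dist_comm (u := up) (v := tum)
    have c2 := A.dist_comm (u := up) (v := tup)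
    have c3 := A.dist_comm (u := tum) (v := tup)
    omega
  exact fun x => ⟨hA.dist_le_of_dist_eq_diam hsize hlong hDlen hdist,
    hA.dist_le_of_dist_eq_diam hsize hlong hdist hDlen⟩
end

section
/- Let A be a finite tree and let D and D' be two distinct diametral paths of A (paths of length diam(A)) that share at least one edge, and let C be the path formed by their common edges. Then each endpoint of C is either a leaf of A (a vertex of degree 1) or a vertex of degree at least 3 in A; in particular, no endpoint of C has degree 2 in A. -/
namespace SimpleGraph

variable {V : Type*} {G : SimpleGraph V} {u v w b : V}

/-- In a tree, every path is a geodesic. -/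
lemma IsTree.length_eq_dist_of_isPath_s6 (hG : G.IsTree) {p : G.Walk u v} (hp : p.IsPath) :
    p.length = G.dist u v := by
  obtain ⟨q, hq, hlen⟩ := hG.connected.exists_path_of_dist u v
  have heq : p = q := congrArg Subtype.val <|
    (hG.isAcyclic.subsingleton_path u v).elim ⟨p, hp⟩ ⟨q, hq⟩
  rw [heq, hlen]

/-- In a finite tree, a path of length `diam` contains every edge at its first vertex. -/
lemma IsTree.mem_edges_of_adj_start [Finite V] (hG : G.IsTree) {p : G.Walk u v} (hp : p.IsPath)
    (hlen : p.length = G.diam) (h : G.Adj u b) : s(u, b) ∈ p.edges := by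
  classical
  by_cases hb : b ∈ p.support
  · have heq : p.takeUntil b hb = .cons h .nil := congrArg Subtype.val <|
      (hG.isAcyclic.subsingleton_path u b).elim ⟨p.takeUntil b hb, hp.takeUntil hb⟩
        ⟨.cons h .nil, by simpa using h.ne⟩
    exact p.edges_takeUntil_subset_edges hb (by simp [heq])
  · have hdist := hG.length_eq_dist_of_isPath_s6 (hp.cons hb (h := h.symm))
    have := hG.connected.nonempty
    have hle : G.dist b v ≤ G.diam := dist_le_diam (connected_iff_ediam_ne_top.mp hG.connected)
    rw [Walk.length_cons] at hdist
    omega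

/-- In a finite tree, a path of length `diam` contains every edge at any of its vertices of degree
at most `2`. -/
lemma IsTree.mem_edges_of_degree_le_two [Fintype V] [DecidableRel G.Adj] (hG : G.IsTree)
    {p : G.Walk u v} (hp : p.IsPath) (hlen : p.length = G.diam) (hw : w ∈ p.support)
    (hdeg : G.degree w ≤ 2) (h : G.Adj w b) : s(w, b) ∈ p.edges := by
  classical
  obtain ⟨q, r, -, -, rfl⟩ := hp.mem_support_iff_exists_append.mp hw
  by_cases hq : q.Nil
  · obtain rfl := hq.eq
    exact hG.mem_edges_of_adj_start hp hlen h
  by_cases hr : r.Nil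
  · obtain rfl := hr.eq
    simpa [or_comm] using hG.mem_edges_of_adj_start hp.reverse
      ((Walk.length_reverse _).trans hlen) h
  have hne : q.penultimate ≠ r.snd := fun heq ↦
    hp.disjoint_support_of_append hr (q.getVert_mem_support _)
      (by rw [← Walk.penultimate, heq]; exact r.tail.start_mem_support)
  have hsub : {q.penultimate, r.snd} ⊆ G.neighborFinset w := by
    simp [Finset.insert_subset_iff, (q.adj_penultimate hq).symm, r.adj_snd hr]
  have hb : b ∈ ({q.penultimate, r.snd} : Finset V) := by
    rw [Finset.eq_of_subset_of_card_le hsub (by rw [Finset.card_pair hne]; exact hdeg)]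
    simpa using h
  rw [Walk.edges_append, List.mem_append]
  rcases Finset.mem_insert.mp hb with rfl | hb
  · exact .inl (Sym2.eq_swap ▸ Walk.mk_penultimate_end_mem_edges hq)
  · rw [Finset.mem_singleton.mp hb]
    exact .inr (Walk.mk_start_snd_mem_edges hr)

/-- In a finite tree, the first vertex of the common part of two paths of length `diam` is a leaf
or a branching point. -/
lemma IsTree.degree_start_of_common_part [Fintype V] [DecidableRel G.Adj]
    (hG : G.IsTree) {u' v' x : V} {p : G.Walk u v} (hp : p.IsPath) (hlen : p.length = G.diam)
    {p' : G.Walk u' v'} (hp' : p'.IsPath) (hlen' : p'.length = G.diam)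
    {c : G.Walk w x} (hc : c.IsPath) (hnil : ¬ c.Nil)
    (hedges : ∀ e, e ∈ c.edges ↔ e ∈ p.edges ∧ e ∈ p'.edges) :
    G.degree w = 1 ∨ 3 ≤ G.degree w := by
  by_contra! hcon
  have hdeg : G.degree w ≤ 2 := by omega
  obtain ⟨h, h'⟩ := (hedges _).mp (Walk.mk_start_snd_mem_edges hnil)
  refine hcon.1 (degree_eq_one_iff_existsUnique_adj.mpr ⟨c.snd, c.adj_snd hnil, fun b hb ↦ ?_⟩)
  exact hc.eq_snd_of_mem_edges <| (hedges _).mpr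
    ⟨hG.mem_edges_of_degree_le_two hp hlen (p.fst_mem_support_of_mem_edges h) hdeg hb,
      hG.mem_edges_of_degree_le_two hp' hlen' (p'.fst_mem_support_of_mem_edges h') hdeg hb⟩

end SimpleGraph

/-- **Endpoints of the common part of two distinct diametral paths are leaves or
branching points.**
Let `A` be a finite tree and let `D, D'` be two distinct diametral paths of `A` (paths of
length `diam A`, with distinct edge sets) sharing at least one edge, and let `C` be the
path formed by their common edges.  Then each endpoint of `C` is either a leaf of `A`
(a vertex of degree `1`) or a vertex of degree at least `3` in `A`; in particular no
endpoint of `C` has degree `2` in `A`. -/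
theorem endpoints_of_common_part_leaf_or_branch
    {V : Type*} [Fintype V] [DecidableEq V]
    (A : SimpleGraph V) [DecidableRel A.Adj]
    (hA : A.IsTree)
    {u v u' v' : V}
    (D : A.Walk u v) (hD : D.IsPath) (hDlen : D.length = A.diam)
    (D' : A.Walk u' v') (hD' : D'.IsPath) (hD'len : D'.length = A.diam)
    (hdistinct : D.edges.toFinset ≠ D'.edges.toFinset)
    (hshare : (D.edges.toFinset ∩ D'.edges.toFinset).Nonempty)
    {w x : V} (C : A.Walk w x) (hC : C.IsPath)
    (hCedges : C.edges.toFinset = D.edges.toFinset ∩ D'.edges.toFinset) :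
    (A.degree w = 1 ∨ 3 ≤ A.degree w) ∧ (A.degree x = 1 ∨ 3 ≤ A.degree x) := by
  have hedges : ∀ e, e ∈ C.edges ↔ e ∈ D.edges ∧ e ∈ D'.edges := fun e ↦ by
    simpa using Finset.ext_iff.mp hCedges e
  have hnil : ¬ C.Nil := fun h ↦ by
    obtain ⟨e, he⟩ := hCedges ▸ hshare
    simp [SimpleGraph.Walk.edges_eq_nil.mpr h] at he
  exact ⟨hA.degree_start_of_common_part hD hDlen hD' hD'len hC hnil hedges,
    hA.degree_start_of_common_part hD hDlen hD' hD'len hC.reverse (by simpa using hnil)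
      (by simpa using hedges)⟩
end
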